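/- Let T be an ergodic conservative infinite measure preserving transformation such that the symmetric power U_T^{⊙k} of its Koopman operator has simple spectrum. Then the Koopman operator of T^{⊙(k-1)} × T, which equals U_T^{⊙(k-1)} ⊗ U_T, has homogeneous spectrum of multiplicity k. -/

import Mathlib

open MeasureTheory
open scoped ENNReal

/-- The underlying (a.e. defined) function of an element of `L²`. -/
noncomputable def lpFun {α : Type*} [MeasurableSpace α] {μ : MeasureTheory.Measure α}
    (f : MeasureTheory.Lp ℂ 2 μ) : α → ℂ := ↑↑f

/-- A unitary operator has *simple spectrum* if it admits a cyclic vector. -/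
def HasSimpleSpectrum {E : Type*} [NormedAddCommGroup E] [InnerProductSpace ℂ E]
    (U : E ≃ₗᵢ[ℂ] E) : Prop :=
  ∃ ξ : E, Dense (Submodule.span ℂ (Set.range fun n : ℤ => (U ^ n) ξ) : Set E)

/-- A unitary operator has *homogeneous spectrum of multiplicity `m`* if it is
unitarily equivalent to the direct sum of `m` copies of a unitary operator with
simple spectrum. -/
def HasHomogeneousSpectrumOfMultiplicity {E : Type*} [NormedAddCommGroup E]
    [InnerProductSpace ℂ E] (U : E ≃ₗᵢ[ℂ] E) (m : ℕ) : Prop :=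
  ∃ (H₀ : Type) (_ : NormedAddCommGroup H₀) (_ : InnerProductSpace ℂ H₀)
    (W : H₀ ≃ₗᵢ[ℂ] H₀), HasSimpleSpectrum W ∧
    ∃ e : E ≃ₗᵢ[ℂ] PiLp 2 (fun _ : Fin m => H₀),
      ∀ (f : E) (i : Fin m), e (U f) i = W (e f i)

/-- The closed subspace of `L²(μ)` of functions invariant (a.e.) under each of a
given family of measure preserving transformations. -/
noncomputable def aeInvariantSubmodule {α : Type*} [MeasurableSpace α]
    (μ : Measure α) (S : Set (α → α))
    (hS : ∀ T ∈ S, MeasurePreserving T μ μ) : Submodule ℂ (Lp ℂ 2 μ) where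
  carrier := {f | ∀ T ∈ S, (↑↑f ∘ T : α → ℂ) =ᵐ[μ] ↑↑f}
  add_mem' := by
    intro f g hf hg T hT
    have h1 := (hS T hT).quasiMeasurePreserving.ae_eq (Lp.coeFn_add f g)
    filter_upwards [h1, hf T hT, hg T hT, Lp.coeFn_add f g] with x e1 e2 e3 e4
    simp only [Function.comp_apply, Pi.add_apply] at *
    rw [e1, e2, e3, e4]
  zero_mem' := by
    intro T hT
    have h1 := (hS T hT).quasiMeasurePreserving.ae_eq (Lp.coeFn_zero ℂ 2 μ)
    filter_upwards [h1, Lp.coeFn_zero ℂ 2 μ] with x e1 e2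
    simp only [Function.comp_apply, Pi.zero_apply] at *
    rw [e1, e2]
  smul_mem' := by
    intro c f hf T hT
    have h1 := (hS T hT).quasiMeasurePreserving.ae_eq (Lp.coeFn_smul c f)
    filter_upwards [h1, hf T hT, Lp.coeFn_smul c f] with x e1 e2 e3
    simp only [Function.comp_apply, Pi.smul_apply] at *
    rw [e1, e2, e3]

/-- Permuting the coordinates of `X^k` preserves the product measure `μ^k`. -/
theorem permMeasurePreserving {X : Type*} [MeasurableSpace X] (k : ℕ)
    (μ : Measure X) [SigmaFinite μ] (γ : Equiv.Perm (Fin k)) :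
    MeasurePreserving (fun x : Fin k → X => x ∘ γ)
      (Measure.pi fun _ => μ) (Measure.pi fun _ => μ) := by
  have h := measurePreserving_piCongrLeft (fun _ : Fin k => μ) γ.symm
  convert h using 1
  funext x i
  show x (γ i) = _
  rw [MeasurableEquiv.coe_piCongrLeft]
  have h2 := Equiv.piCongrLeft_apply_apply (fun _ : Fin k => X) γ.symm x (γ i)
  simpa using h2.symm

/-- The subspace of `L²(X^k, μ^k)` of functions invariant under a subgroup
`Γ ≤ S_k` permuting the coordinates. -/
noncomputable def permInvariantSubspace {X : Type*} [MeasurableSpace X] (k : ℕ)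
    (μ : Measure X) [SigmaFinite μ] (Γ : Subgroup (Equiv.Perm (Fin k))) :
    Submodule ℂ (Lp ℂ 2 (Measure.pi fun _ : Fin k => μ)) :=
  aeInvariantSubmodule _ {g | ∃ γ ∈ Γ, g = fun x => x ∘ γ}
    (by rintro g ⟨γ, -, rfl⟩; exact permMeasurePreserving k μ γ)

/-- A strict total order on a finite type lists its elements in increasing order. -/
theorem exists_equiv_fin_of_isStrictTotalOrder {α : Type*} [Fintype α] (r : α → α → Prop)
    [IsStrictTotalOrder α r] {k : ℕ} (hk : Fintype.card α = k) :
    ∃ e : Fin k ≃ α, ∀ a b, a < b → r (e a) (e b) := by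
  classical
  let _ : LinearOrder α := linearOrderOfSTO r
  let e := Fintype.orderIsoFinOfCardEq α hk
  exact ⟨e.toEquiv, fun a b hab => e.lt_iff_lt.2 hab⟩

section Hilbert

variable {E : Type*} [NormedAddCommGroup E] [InnerProductSpace ℂ E] [CompleteSpace E]

/-- An operator mapping `K` into `L` whose adjoint maps `L` into `K` intertwines the orthogonal
projections onto `K` and `L`. -/
theorem apply_starProjection_of_mapsTo {K L : Submodule ℂ E} [K.HasOrthogonalProjection]
    [L.HasOrthogonalProjection] (S : E →L[ℂ] E) (hS : ∀ x ∈ K, S x ∈ L)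
    (hS' : ∀ x ∈ L, star S x ∈ K) (x : E) :
    S (K.starProjection x) = L.starProjection (S x) := by
  symm
  apply Submodule.eq_starProjection_of_mem_orthogonal (hS _ (K.starProjection_apply_mem x))
  rw [← map_sub, Submodule.mem_orthogonal]
  intro u hu
  rw [← ContinuousLinearMap.adjoint_inner_left]
  exact (Submodule.mem_orthogonal _ _).1 (K.sub_starProjection_mem_orthogonal x) _ (hS' u hu)

/-- A positive operator annihilates every vector on which its quadratic form vanishes. -/
theorem apply_eq_zero_of_nonneg_of_inner_eq_zero {N : E →L[ℂ] E} (hN : 0 ≤ N) {x : E}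
    (hx : inner ℂ (N x) x = 0) : N x = 0 := by
  obtain ⟨S, rfl⟩ := CStarAlgebra.nonneg_iff_eq_star_mul_self.1 hN
  have h : S x = 0 := by
    rw [← inner_self_eq_zero (𝕜 := ℂ), ← ContinuousLinearMap.adjoint_inner_left]
    exact hx
  simp [h]

theorem re_inner_apply_nonneg {E : Type*} [NormedAddCommGroup E] [InnerProductSpace ℂ E]
    {N : E →L[ℂ] E} (hN : 0 ≤ N) (x : E) :
    0 ≤ (inner ℂ (N x) x).re :=
  ((ContinuousLinearMap.nonneg_iff_isPositive N).1 hN).re_inner_nonneg_left x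

/-- The spectral subspace of `A - B` for the half-line `(-∞, 0]`. -/
noncomputable def leSubspace (A B : E →L[ℂ] E) : Submodule ℂ E := ((A - B)⁺).ker

theorem mem_leSubspace {A B : E →L[ℂ] E} {x : E} : x ∈ leSubspace A B ↔ (A - B)⁺ x = 0 :=
  LinearMap.mem_ker

theorem isClosed_leSubspace (A B : E →L[ℂ] E) : IsClosed (leSubspace A B : Set E) :=
  ((A - B)⁺).isClosed_ker

noncomputable instance (A B : E →L[ℂ] E) : CompleteSpace (leSubspace A B) :=
  (isClosed_leSubspace A B).completeSpace_coe

theorem mem_leSubspace_swap {A B : E →L[ℂ] E} {x : E} :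
    x ∈ leSubspace B A ↔ (A - B)⁻ x = 0 := by
  rw [mem_leSubspace, ← neg_sub A B, CFC.posPart_neg]

theorem orthogonal_leSubspace_le {A B : E →L[ℂ] E} {x : E}
    (hx : x ∈ (leSubspace A B)ᗮ) : x ∈ leSubspace B A := by
  have hN : IsSelfAdjoint ((A - B)⁻) := (CFC.negPart_nonneg (A - B)).isSelfAdjoint
  rw [mem_leSubspace_swap, ← inner_self_eq_zero (𝕜 := ℂ),
    ← ContinuousLinearMap.adjoint_inner_left, ← ContinuousLinearMap.star_eq_adjoint, hN.star_eq]
  refine (Submodule.mem_orthogonal _ _).1 hx _ ?_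
  rw [mem_leSubspace]
  exact DFunLike.congr_fun (CFC.posPart_mul_negPart (A - B)) ((A - B)⁻ x)

theorem apply_eq_of_mem_leSubspace {A B : E →L[ℂ] E} (hA : IsSelfAdjoint A)
    (hB : IsSelfAdjoint B) {x : E} (h : x ∈ leSubspace A B) (h' : x ∈ leSubspace B A) :
    A x = B x := by
  rw [mem_leSubspace] at h
  rw [mem_leSubspace_swap] at h'
  have := DFunLike.congr_fun (CFC.posPart_sub_negPart (A - B) (hA.sub hB)) x
  rw [sub_apply, h, h', sub_zero, sub_apply] at this
  exact sub_eq_zero.1 this.symm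

theorem apply_eq_of_mem_leSubspace_cycle {A B C : E →L[ℂ] E} (hA : IsSelfAdjoint A)
    (hB : IsSelfAdjoint B) (hC : IsSelfAdjoint C) {x : E} (h₁ : x ∈ leSubspace A B)
    (h₂ : x ∈ leSubspace B C) (h₃ : x ∈ leSubspace C A) : A x = B x := by
  have key : ∀ {S R : E →L[ℂ] E}, IsSelfAdjoint S → IsSelfAdjoint R → x ∈ leSubspace S R →
      (S - R)⁻ x = R x - S x := by
    intro S R hS hR h
    rw [mem_leSubspace] at h
    have := DFunLike.congr_fun (CFC.posPart_sub_negPart (S - R) (hS.sub hR)) x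
    rw [sub_apply, h, zero_sub, sub_apply] at this
    rw [← neg_sub (S x), ← this, neg_neg]
  have e₁ := key hA hB h₁
  have e₂ := key hB hC h₂
  have e₃ := key hC hA h₃
  have hsum : (A - B)⁻ x + (B - C)⁻ x + (C - A)⁻ x = 0 := by rw [e₁, e₂, e₃]; abel
  have hre : (inner ℂ ((A - B)⁻ x) x).re + (inner ℂ ((B - C)⁻ x) x).re
      + (inner ℂ ((C - A)⁻ x) x).re = 0 := by
    rw [← Complex.add_re, ← Complex.add_re, ← inner_add_left, ← inner_add_left, hsum]
    simp
  have p₁ := re_inner_apply_nonneg (CFC.negPart_nonneg (A - B)) x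
  have p₂ := re_inner_apply_nonneg (CFC.negPart_nonneg (B - C)) x
  have p₃ := re_inner_apply_nonneg (CFC.negPart_nonneg (C - A)) x
  have hpos := (ContinuousLinearMap.nonneg_iff_isPositive _).1 (CFC.negPart_nonneg (A - B))
  have hz : inner ℂ ((A - B)⁻ x) x = 0 := by
    have h1 : inner ℂ ((A - B)⁻ x) x = ((inner ℂ ((A - B)⁻ x) x).re : ℂ) :=
      (Complex.conj_eq_iff_re.1 (by
        rw [inner_conj_symm]; exact (hpos.isSymmetric x x).symm)).symm
    rw [h1, show (inner ℂ ((A - B)⁻ x) x).re = 0 by linarith]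
    simp
  have := apply_eq_zero_of_nonneg_of_inner_eq_zero (CFC.negPart_nonneg (A - B)) hz
  rw [e₁, sub_eq_zero] at this
  exact this.symm

theorem apply_mem_leSubspace_of_commute {A B S : E →L[ℂ] E} (hA : Commute A S)
    (hB : Commute B S) {x : E} (hx : x ∈ leSubspace A B) : S x ∈ leSubspace A B := by
  have h : Commute ((A - B)⁺) S := by
    rw [CFC.posPart_def]
    exact (hA.sub_left hB).cfcₙ_real _
  rw [mem_leSubspace] at hx ⊢
  have := DFunLike.congr_fun h.eq x
  simpa [hx] using this

theorem commute_starProjection_leSubspace {A B S : E →L[ℂ] E} (hA : Commute A S)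
    (hB : Commute B S) (hA' : Commute A (star S)) (hB' : Commute B (star S)) :
    Commute S (leSubspace A B).starProjection :=
  ContinuousLinearMap.ext fun x => apply_starProjection_of_mapsTo S
    (fun _ => apply_mem_leSubspace_of_commute hA hB)
    (fun _ => apply_mem_leSubspace_of_commute hA' hB') x

theorem apply_mem_leSubspace_of_semiconj {A B A' B' : E →L[ℂ] E} (hA : IsSelfAdjoint A)
    (hB : IsSelfAdjoint B) (e : E ≃ₗᵢ[ℂ] E)
    (heA : ∀ x, e (A x) = A' (e x)) (heB : ∀ x, e (B x) = B' (e x)) {x : E}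
    (hx : x ∈ leSubspace A B) : e x ∈ leSubspace A' B' := by
  have hconj : e.conjStarAlgEquiv (A - B) = A' - B' := by
    ext y
    simp [heA, heB]
  have hpos : e.conjStarAlgEquiv ((A - B)⁺) = (A' - B')⁺ := by
    have h := CFC.posPart_negPart_unique (a := A' - B') (b := e.conjStarAlgEquiv ((A - B)⁺))
      (c := e.conjStarAlgEquiv ((A - B)⁻))
      (by rw [← map_sub, CFC.posPart_sub_negPart _ (hA.sub hB), hconj])
      (by rw [← map_mul, CFC.posPart_mul_negPart, map_zero])
      (map_nonneg _ (CFC.posPart_nonneg _)) (map_nonneg _ (CFC.negPart_nonneg _))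
    exact h.1.symm
  rw [mem_leSubspace] at hx ⊢
  rw [← hpos, LinearIsometryEquiv.conjStarAlgEquiv_apply_apply, e.symm_apply_apply, hx, map_zero]

variable {k : ℕ}

/-- The joint spectral subspace of the commuting operators `A i` for the cone of points whose
coordinates are arranged by `σ` in increasing order. -/
noncomputable def orderSubspace (A : Fin k → E →L[ℂ] E) (σ : Equiv.Perm (Fin k)) :
    Submodule ℂ E :=
  ⨅ (a : Fin k) (b : Fin k) (_ : a < b), leSubspace (A (σ a)) (A (σ b))

theorem mem_orderSubspace {A : Fin k → E →L[ℂ] E} {σ : Equiv.Perm (Fin k)} {x : E} :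
    x ∈ orderSubspace A σ ↔ ∀ a b, a < b → x ∈ leSubspace (A (σ a)) (A (σ b)) := by
  simp only [orderSubspace, Submodule.mem_iInf]

noncomputable instance (A : Fin k → E →L[ℂ] E) (σ : Equiv.Perm (Fin k)) :
    CompleteSpace (orderSubspace A σ) := by
  refine IsClosed.completeSpace_coe (hs := ?_)
  simp only [orderSubspace, Submodule.coe_iInf]
  exact isClosed_iInter fun a => isClosed_iInter fun b => isClosed_iInter fun _ =>
    isClosed_leSubspace _ _

theorem apply_mem_orderSubspace_of_commute {A : Fin k → E →L[ℂ] E} {σ : Equiv.Perm (Fin k)}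
    {S : E →L[ℂ] E} (hS : ∀ i, Commute (A i) S) {x : E} (hx : x ∈ orderSubspace A σ) :
    S x ∈ orderSubspace A σ :=
  mem_orderSubspace.2 fun a b hab =>
    apply_mem_leSubspace_of_commute (hS _) (hS _) (mem_orderSubspace.1 hx a b hab)

/-- The spectral projection of `A i - A j` for the half-line `(-∞, 0]`. -/
noncomputable def leProjection (A : Fin k → E →L[ℂ] E) (i j : Fin k) : E →L[ℂ] E :=
  (leSubspace (A i) (A j)).starProjection

theorem leProjection_apply_eq_self_iff {A : Fin k → E →L[ℂ] E} {i j : Fin k} {x : E} :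
    leProjection A i j x = x ↔ x ∈ leSubspace (A i) (A j) :=
  Submodule.starProjection_eq_self_iff

theorem leProjection_isSelfAdjoint (A : Fin k → E →L[ℂ] E) (i j : Fin k) :
    IsSelfAdjoint (leProjection A i j) :=
  isStarProjection_starProjection.isSelfAdjoint

theorem leProjection_apply_mem (A : Fin k → E →L[ℂ] E) (i j : Fin k) (x : E) :
    leProjection A i j x ∈ leSubspace (A i) (A j) :=
  Submodule.starProjection_apply_mem _ _

theorem mem_leSubspace_of_leProjection_apply_eq_zero {A : Fin k → E →L[ℂ] E} {i j : Fin k} {x : E}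
    (h : leProjection A i j x = 0) : x ∈ leSubspace (A j) (A i) :=
  orthogonal_leSubspace_le ((Submodule.starProjection_apply_eq_zero_iff _).1 h)

section Commuting

variable {A : Fin k → E →L[ℂ] E} (hA : ∀ i, IsSelfAdjoint (A i))
  (hcomm : ∀ i j, Commute (A i) (A j))

include hA hcomm

theorem commute_leProjection (i j l : Fin k) : Commute (A l) (leProjection A i j) :=
  commute_starProjection_leSubspace (hcomm _ _) (hcomm _ _)
    (by rw [(hA l).star_eq]; exact hcomm _ _) (by rw [(hA l).star_eq]; exact hcomm _ _)

theorem leProjection_commute (i j l m : Fin k) :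
    Commute (leProjection A i j) (leProjection A l m) :=
  commute_starProjection_leSubspace (commute_leProjection hA hcomm _ _ _)
    (commute_leProjection hA hcomm _ _ _)
    (by rw [(leProjection_isSelfAdjoint A i j).star_eq]; exact commute_leProjection hA hcomm _ _ _)
    (by rw [(leProjection_isSelfAdjoint A i j).star_eq]; exact commute_leProjection hA hcomm _ _ _)

/-- A nonzero vector can be cut down to a nonzero joint eigenvector of finitely many of the
projections `leProjection A i j`. -/
theorem exists_forall_leProjection_apply {N : Submodule ℂ E}
    (hN : ∀ i j, ∀ x ∈ N, leProjection A i j x ∈ N) {x : E} (hx : x ∈ N) (hx0 : x ≠ 0)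
    (s : Finset (Fin k × Fin k)) :
    ∃ y ∈ N, y ≠ 0 ∧ ∀ p ∈ s, leProjection A p.1 p.2 y = 0 ∨ leProjection A p.1 p.2 y = y := by
  classical
  induction s using Finset.induction_on with
  | empty => exact ⟨x, hx, hx0, by simp⟩
  | insert q s _ ih =>
    obtain ⟨y, hy, hy0, h⟩ := ih
    by_cases hq : leProjection A q.1 q.2 y = 0
    · refine ⟨y, hy, hy0, fun p hp => ?_⟩
      rcases Finset.mem_insert.1 hp with rfl | hp
      exacts [Or.inl hq, h p hp]
    · refine ⟨leProjection A q.1 q.2 y, hN _ _ _ hy, hq, fun p hp => ?_⟩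
      rcases Finset.mem_insert.1 hp with rfl | hp
      · exact Or.inr (leProjection_apply_eq_self_iff.2 (leProjection_apply_mem _ _ _ _))
      · have hc : leProjection A p.1 p.2 (leProjection A q.1 q.2 y) =
            leProjection A q.1 q.2 (leProjection A p.1 p.2 y) :=
          DFunLike.congr_fun (leProjection_commute hA hcomm p.1 p.2 q.1 q.2).eq y
        rcases h p hp with h | h
        · exact Or.inl (by rw [hc, h, map_zero])
        · exact Or.inr (by rw [hc, h])

variable (hinj : ∀ i j, i ≠ j → ∀ x, A i x = A j x → x = 0)

include hinj

omit hcomm in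
theorem eq_zero_of_mem_leSubspace {i j : Fin k} (hij : i ≠ j) {x : E}
    (h : x ∈ leSubspace (A i) (A j)) (h' : x ∈ leSubspace (A j) (A i)) : x = 0 :=
  hinj i j hij x (apply_eq_of_mem_leSubspace (hA i) (hA j) h h')

theorem inner_eq_zero_of_mem_leSubspace {i j : Fin k} (hij : i ≠ j) {x y : E}
    (hx : x ∈ leSubspace (A i) (A j)) (hy : y ∈ leSubspace (A j) (A i)) : inner ℂ x y = 0 := by
  have h : leProjection A i j y = 0 := by
    refine eq_zero_of_mem_leSubspace hA hinj hij (leProjection_apply_mem _ _ _ _) ?_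
    exact apply_mem_leSubspace_of_commute (commute_leProjection hA hcomm _ _ _)
      (commute_leProjection hA hcomm _ _ _) hy
  rw [← leProjection_apply_eq_self_iff.2 hx, ← (leProjection_isSelfAdjoint A i j).star_eq,
    ContinuousLinearMap.star_eq_adjoint, ContinuousLinearMap.adjoint_inner_left, h,
    inner_zero_right]

theorem inner_eq_zero_of_mem_orderSubspace {σ τ : Equiv.Perm (Fin k)} (hne : σ ≠ τ) {x y : E}
    (hx : x ∈ orderSubspace A σ) (hy : y ∈ orderSubspace A τ) : inner ℂ x y = 0 := by
  obtain ⟨a, b, hab, h⟩ : ∃ a b, a < b ∧ τ.symm (σ b) < τ.symm (σ a) := by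
    by_contra! hcon
    apply hne
    have hmono : StrictMono (σ.trans τ.symm) := fun a b hab =>
      lt_of_le_of_ne (hcon a b hab) fun h => hab.ne ((σ.trans τ.symm).injective h)
    have hid : (σ.trans τ.symm : Fin k → Fin k) = id :=
      (hmono.range_inj strictMono_id).1 (by rw [Equiv.range_eq_univ, Set.range_id])
    ext1 a
    have := congrFun hid a
    simpa [Equiv.symm_apply_eq] using this
  have h₁ := mem_orderSubspace.1 hx a b hab
  have h₂ := mem_orderSubspace.1 hy _ _ h
  rw [τ.apply_symm_apply, τ.apply_symm_apply] at h₂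
  exact inner_eq_zero_of_mem_leSubspace hA hcomm hinj (fun h => hab.ne (σ.injective h)) h₁ h₂

theorem eq_zero_of_forall_mem_orthogonal_orderSubspace {x : E}
    (hx : ∀ σ, x ∈ (orderSubspace A σ)ᗮ) : x = 0 := by
  classical
  by_contra hx0
  have hN : ∀ i j, ∀ x ∈ ⨅ σ, (orderSubspace A σ)ᗮ, leProjection A i j x ∈
      ⨅ σ, (orderSubspace A σ)ᗮ := by
    intro i j x hx
    simp only [Submodule.mem_iInf, Submodule.mem_orthogonal] at hx ⊢
    intro σ u hu
    rw [← ContinuousLinearMap.adjoint_inner_left, ← ContinuousLinearMap.star_eq_adjoint,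
      (leProjection_isSelfAdjoint A i j).star_eq]
    exact hx σ _ (apply_mem_orderSubspace_of_commute
      (fun l => commute_leProjection hA hcomm i j l) hu)
  obtain ⟨y, hy, hy0, hdec⟩ := exists_forall_leProjection_apply hA hcomm hN
    ((Submodule.mem_iInf _).2 hx) hx0 Finset.univ
  let r : Fin k → Fin k → Prop := fun i j => i ≠ j ∧ y ∈ leSubspace (A i) (A j)
  have hasymm : ∀ {i j}, r i j → r j i → False := fun h h' =>
    hy0 (eq_zero_of_mem_leSubspace hA hinj h.1 h.2 h'.2)
  have htotal : ∀ i j, i ≠ j → r i j ∨ r j i := by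
    intro i j hij
    rcases hdec (i, j) (Finset.mem_univ _) with h | h
    · exact Or.inr ⟨hij.symm, mem_leSubspace_of_leProjection_apply_eq_zero h⟩
    · exact Or.inl ⟨hij, leProjection_apply_eq_self_iff.1 h⟩
  have : IsStrictTotalOrder (Fin k) r :=
    { trichotomous := fun i j h h' => by
        by_contra hij
        exact (htotal i j hij).elim h h'
      irrefl := fun i h => h.1 rfl
      trans := fun i j l hij hjl => by
        have hil : i ≠ l := by
          rintro rfl
          exact hasymm hij hjl
        refine (htotal i l hil).resolve_right fun hli => hy0 (hinj i j hij.1 y ?_)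
        exact apply_eq_of_mem_leSubspace_cycle (hA i) (hA j) (hA l) hij.2 hjl.2 hli.2 }
  obtain ⟨σ, hσ⟩ : ∃ σ : Equiv.Perm (Fin k), ∀ a b, a < b → r (σ a) (σ b) :=
    exists_equiv_fin_of_isStrictTotalOrder r (Fintype.card_fin k)
  have hmem : y ∈ orderSubspace A σ := mem_orderSubspace.2 fun a b hab => (hσ a b hab).2
  exact hy0 (inner_self_eq_zero.1
    ((Submodule.mem_orthogonal _ _).1 ((Submodule.mem_iInf _).1 hy σ) y hmem))

theorem sum_starProjection_orderSubspace (x : E) :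
    ∑ σ, (orderSubspace A σ).starProjection x = x := by
  symm
  rw [← sub_eq_zero]
  refine eq_zero_of_forall_mem_orthogonal_orderSubspace hA hcomm hinj fun τ => ?_
  rw [Submodule.mem_orthogonal]
  intro u hu
  rw [inner_sub_right, inner_sum, Finset.sum_eq_single τ]
  · rw [← inner_sub_right]
    exact (Submodule.mem_orthogonal _ _).1 (Submodule.sub_starProjection_mem_orthogonal x) u hu
  · intro σ _ hσ
    exact inner_eq_zero_of_mem_orderSubspace hA hcomm hinj hσ.symm hu
      (Submodule.starProjection_apply_mem _ _)
  · simp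

end Commuting

end Hilbert

section Spectrum

theorem intertwine_zpow {E F : Type*} [NormedAddCommGroup E] [InnerProductSpace ℂ E]
    [NormedAddCommGroup F] [InnerProductSpace ℂ F] {U : E ≃ₗᵢ[ℂ] E} {W : F ≃ₗᵢ[ℂ] F}
    {J : E → F} (h : ∀ x, J (U x) = W (J x)) (n : ℤ) (x : E) :
    J ((U ^ n) x) = (W ^ n) (J x) := by
  induction n using Int.induction_on generalizing x with
  | zero => simp
  | succ n ih =>
    rw [zpow_add_one, zpow_add_one]
    exact (ih (U x)).trans (congrArg _ (h x))
  | pred n ih =>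
    rw [zpow_sub_one, zpow_sub_one]
    have hinv : J (U⁻¹ x) = W⁻¹ (J x) := by
      apply W.injective
      rw [← h]
      exact (congrArg J (U.apply_symm_apply x)).trans (W.apply_symm_apply (J x)).symm
    exact (ih (U⁻¹ x)).trans (congrArg _ hinv)

/-- Simple spectrum passes to factors. -/
theorem HasSimpleSpectrum.of_surjective {E F : Type*} [NormedAddCommGroup E]
    [InnerProductSpace ℂ E] [NormedAddCommGroup F] [InnerProductSpace ℂ F] {U : E ≃ₗᵢ[ℂ] E}
    {W : F ≃ₗᵢ[ℂ] F} (hU : HasSimpleSpectrum U) (J : E →L[ℂ] F) (hJ : Function.Surjective J)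
    (h : ∀ x, J (U x) = W (J x)) : HasSimpleSpectrum W := by
  obtain ⟨ξ, hξ⟩ := hU
  refine ⟨J ξ, ?_⟩
  have hd := hJ.denseRange.dense_image J.continuous hξ
  have himg : (J '' (Submodule.span ℂ (Set.range fun n : ℤ => (U ^ n) ξ) : Set E)) =
      (Submodule.span ℂ (Set.range fun n : ℤ => (W ^ n) (J ξ)) : Set F) := by
    have := Submodule.map_span (J : E →ₗ[ℂ] F) (Set.range fun n : ℤ => (U ^ n) ξ)
    rw [← Set.range_comp] at this
    have h2 : (J : E →ₗ[ℂ] F) ∘ (fun n : ℤ => (U ^ n) ξ) = fun n : ℤ => (W ^ n) (J ξ) :=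
      funext fun n => intertwine_zpow (J := J) h n ξ
    rw [h2] at this
    rw [← this]
    rfl
  rwa [himg] at hd

theorem HasSimpleSpectrum.separableSpace {E : Type*} [NormedAddCommGroup E]
    [InnerProductSpace ℂ E] {U : E ≃ₗᵢ[ℂ] E} (hU : HasSimpleSpectrum U) :
    TopologicalSpace.SeparableSpace E := by
  obtain ⟨ξ, hξ⟩ := hU
  rw [← TopologicalSpace.isSeparable_univ_iff, ← hξ.closure_eq]
  exact ((Set.countable_range _).isSeparable.span (R := ℂ)).closure

/-- A separable Hilbert space is isometric to one living in the lowest universe. -/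
theorem exists_linearIsometryEquiv_type (E : Type*) [NormedAddCommGroup E]
    [InnerProductSpace ℂ E] [CompleteSpace E] [TopologicalSpace.SeparableSpace E] :
    ∃ (H : Type) (_ : NormedAddCommGroup H) (_ : InnerProductSpace ℂ H), Nonempty (E ≃ₗᵢ[ℂ] H) := by
  obtain ⟨w, b, hb⟩ := exists_hilbertBasis ℂ E
  have hw : Countable w := by
    refine Pairwise.countable_of_isOpen_disjoint (s := fun i => Metric.ball (b i) (1 / 2))
      (fun i j hij => Metric.ball_disjoint_ball ?_) (fun _ => Metric.isOpen_ball)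
      (fun i => ⟨b i, Metric.mem_ball_self (by norm_num)⟩)
    have h₁ : inner ℂ (b i) (b i - b j) = 1 := by
      rw [inner_sub_right, b.orthonormal.2 hij, inner_self_eq_norm_sq_to_K, b.orthonormal.1 i]
      simp
    have h₂ := norm_inner_le_norm (𝕜 := ℂ) (b i) (b i - b j)
    rw [h₁, b.orthonormal.1 i, norm_one, one_mul] at h₂
    rw [dist_eq_norm]
    linarith
  obtain ⟨f, hf⟩ := exists_injective_nat w
  let v : Set.range f → E := fun n => b ((Equiv.ofInjective f hf).symm n)
  have hv : Orthonormal ℂ v := b.orthonormal.comp _ (Equiv.injective _)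
  have hr : Set.range v = Set.range b := (Equiv.ofInjective f hf).symm.surjective.range_comp b
  exact ⟨_, _, _, ⟨(HilbertBasis.mk hv (by rw [hr, b.dense_span])).repr⟩⟩

theorem HasSimpleSpectrum.exists_type {E : Type*} [NormedAddCommGroup E]
    [InnerProductSpace ℂ E] [CompleteSpace E] {U : E ≃ₗᵢ[ℂ] E} (hU : HasSimpleSpectrum U) :
    ∃ (H : Type) (_ : NormedAddCommGroup H) (_ : InnerProductSpace ℂ H) (W : H ≃ₗᵢ[ℂ] H)
      (e : E ≃ₗᵢ[ℂ] H), HasSimpleSpectrum W ∧ ∀ x, e (U x) = W (e x) := by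
  have := hU.separableSpace
  obtain ⟨H, i₁, i₂, ⟨e⟩⟩ := exists_linearIsometryEquiv_type E
  refine ⟨H, i₁, i₂, (e.symm.trans U).trans e, e, ?_, fun x => by simp⟩
  exact hU.of_surjective (e : E →L[ℂ] H) e.surjective fun x => by simp

/-- The restriction of a unitary operator to a subspace invariant under it and its inverse. -/
noncomputable def LinearIsometryEquiv.restrictInvariant {E : Type*} [NormedAddCommGroup E]
    [InnerProductSpace ℂ E] (V : E ≃ₗᵢ[ℂ] E) (K : Submodule ℂ E) (h : ∀ x ∈ K, V x ∈ K)
    (h' : ∀ x ∈ K, V.symm x ∈ K) : K ≃ₗᵢ[ℂ] K where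
  toFun x := ⟨V x, h x x.2⟩
  invFun x := ⟨V.symm x, h' x x.2⟩
  map_add' _ _ := Subtype.ext (map_add V _ _)
  map_smul' _ _ := Subtype.ext (V.map_smul _ _)
  left_inv _ := Subtype.ext (V.symm_apply_apply _)
  right_inv _ := Subtype.ext (V.apply_symm_apply _)
  norm_map' x := V.norm_map x

theorem LinearIsometryEquiv.coe_restrictInvariant_apply {E : Type*} [NormedAddCommGroup E]
    [InnerProductSpace ℂ E] (V : E ≃ₗᵢ[ℂ] E) {K : Submodule ℂ E} (h : ∀ x ∈ K, V x ∈ K)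
    (h' : ∀ x ∈ K, V.symm x ∈ K) (x : K) : (V.restrictInvariant K h h' x : E) = V x :=
  rfl

section Abstract

variable {E : Type*} [NormedAddCommGroup E] [InnerProductSpace ℂ E] {k : ℕ}
  (π : Equiv.Perm (Fin k) →* (E ≃ₗᵢ[ℂ] E)) (K : Submodule ℂ E) [K.HasOrthogonalProjection]

/-- The translates of `K` under the unitary representation `π` form an orthogonal decomposition
of the whole space. -/
structure IsFundamentalSubspace : Prop where
  sum_eq : ∀ x, ∑ γ, π γ (K.starProjection (π γ⁻¹ x)) = x
  apply_eq_zero : ∀ γ, γ ≠ 1 → ∀ x ∈ K, K.starProjection (π γ x) = 0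

variable {π K}

omit [K.HasOrthogonalProjection] in
theorem map_mul_apply' (γ δ : Equiv.Perm (Fin k)) (x : E) : π (γ * δ) x = π γ (π δ x) := by
  rw [map_mul]; rfl

theorem IsFundamentalSubspace.norm_sq (hK : IsFundamentalSubspace π K) (x : E) :
    ‖x‖ ^ 2 = ∑ γ, ‖K.starProjection (π γ x)‖ ^ 2 := by
  have h : ∀ γ, inner ℂ x (π γ (K.starProjection (π γ⁻¹ x))) =
      ((‖K.starProjection (π γ⁻¹ x)‖ : ℂ)) ^ 2 := by
    intro γ
    have hx : x = π γ (π γ⁻¹ x) := by rw [← map_mul_apply', mul_inv_cancel, map_one]; rfl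
    conv_lhs => enter [2]; rw [hx]
    rw [LinearIsometryEquiv.inner_map_map]
    refine Eq.trans ?_ (inner_self_eq_norm_sq_to_K (K.starProjection (π γ⁻¹ x)))
    rw [Submodule.inner_starProjection_left_eq_right,
      Submodule.starProjection_eq_self_iff.2 (Submodule.starProjection_apply_mem _ _)]
  have h2 : ((‖x‖ ^ 2 : ℝ) : ℂ) = ((∑ γ, ‖K.starProjection (π γ⁻¹ x)‖ ^ 2 : ℝ) : ℂ) := by
    push_cast
    have h3 : ((‖x‖ : ℂ)) ^ 2 = inner ℂ x x := (inner_self_eq_norm_sq_to_K x).symm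
    rw [h3]
    conv_lhs => enter [3]; rw [← hK.sum_eq x]
    rw [inner_sum]
    exact Finset.sum_congr rfl fun γ _ => h γ
  rw [Complex.ofReal_inj.1 h2]
  exact Equiv.sum_comp (Equiv.inv _) fun γ => ‖K.starProjection (π γ x)‖ ^ 2

/-- The number of permutations carrying `p` to a given point does not depend on that point. -/
theorem card_perm_apply_eq (p i : Fin k) :
    (Finset.univ.filter fun δ : Equiv.Perm (Fin k) => δ p = i).card =
      (Finset.univ.filter fun δ : Equiv.Perm (Fin k) => δ p = p).card := by
  refine Finset.card_bij (fun δ _ => Equiv.swap p i * δ) ?_ ?_ ?_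
  · intro δ hδ
    simp only [Finset.mem_filter, Finset.mem_univ, true_and] at hδ ⊢
    simp [hδ]
  · intro δ _ δ' _ h
    exact mul_left_cancel h
  · intro δ hδ
    simp only [Finset.mem_filter, Finset.mem_univ, true_and] at hδ
    exact ⟨Equiv.swap p i * δ, by simp [hδ], by simp [← mul_assoc]⟩

section Equivalence

variable (p : Fin k) {F : Submodule ℂ E}
  (hF : ∀ x, x ∈ F ↔ ∀ γ ∈ MulAction.stabilizer (Equiv.Perm (Fin k)) p, π γ x = x)

include hF

omit [K.HasOrthogonalProjection] in
theorem apply_eq_apply_swap_of_mem {x : E} (hx : x ∈ F) (δ : Equiv.Perm (Fin k)) :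
    π δ x = π (Equiv.swap p (δ p)) x := by
  have h := (hF x).1 hx ((Equiv.swap p (δ p))⁻¹ * δ) (by
    rw [MulAction.mem_stabilizer_iff]
    simp)
  conv_rhs => rw [← h, ← map_mul_apply', mul_inv_cancel_left]

theorem IsFundamentalSubspace.norm_sq_of_mem (hK : IsFundamentalSubspace π K) {x : E}
    (hx : x ∈ F) : ‖x‖ ^ 2 =
      (Finset.univ.filter fun δ : Equiv.Perm (Fin k) => δ p = p).card *
        ∑ i, ‖K.starProjection (π (Equiv.swap p i) x)‖ ^ 2 := by
  rw [hK.norm_sq, ← Finset.sum_fiberwise _ fun δ : Equiv.Perm (Fin k) => δ p, Finset.mul_sum]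
  refine Finset.sum_congr rfl fun i _ => ?_
  rw [← card_perm_apply_eq p i, ← nsmul_eq_mul]
  refine Finset.sum_eq_card_nsmul fun δ hδ => ?_
  rw [apply_eq_apply_swap_of_mem p hF hx δ, (Finset.mem_filter.1 hδ).2]

theorem IsFundamentalSubspace.exists_equiv (hK : IsFundamentalSubspace π K) :
    ∃ (c : ℝ) (e : F ≃ₗᵢ[ℂ] PiLp 2 fun _ : Fin k => K), ∀ x i,
      (e x i : E) = (c : ℂ) • K.starProjection (π (Equiv.swap p i) x) := by
  set N : ℕ := (Finset.univ.filter fun δ : Equiv.Perm (Fin k) => δ p = p).card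
  have hN0 : 0 < (N : ℝ) := by
    exact_mod_cast Finset.card_pos.2 ⟨1, by simp⟩
  have hc0 : ((√N : ℝ) : ℂ) ≠ 0 := by
    exact_mod_cast (Real.sqrt_pos.2 hN0).ne'
  let J : F →ₗ[ℂ] PiLp 2 fun _ : Fin k => K :=
    { toFun := fun x => WithLp.toLp 2 fun i =>
        ((√N : ℝ) : ℂ) • K.orthogonalProjectionOnto (π (Equiv.swap p i) (x : E))
      map_add' := fun x y => by ext i; simp
      map_smul' := fun a x => by
        ext i
        simp [-Complex.coe_smul, smul_smul, mul_comm] }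
  have hJ : ∀ x i, (J x i : E) = ((√N : ℝ) : ℂ) • K.starProjection (π (Equiv.swap p i) x) :=
    fun x i => rfl
  have hnorm : ∀ x, ‖J x‖ = ‖x‖ := by
    intro x
    rw [← sq_eq_sq₀ (norm_nonneg _) (norm_nonneg _), PiLp.norm_sq_eq_of_L2,
      ← Submodule.norm_coe x, hK.norm_sq_of_mem p hF x.2, Finset.mul_sum]
    refine Finset.sum_congr rfl fun i _ => ?_
    rw [← Submodule.norm_coe, hJ, norm_smul, mul_pow, Complex.norm_real, Real.norm_eq_abs, sq_abs,
      Real.sq_sqrt hN0.le]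
  have hsurj : Function.Surjective J := by
    intro h
    let y : E := ((√N : ℝ) : ℂ)⁻¹ • ∑ δ : Equiv.Perm (Fin k), π δ⁻¹ (h (δ p) : E)
    have hy : y ∈ F := by
      rw [hF]
      intro γ hγ
      simp only [y, map_smul, map_sum, ← map_mul_apply']
      congr 1
      rw [← Equiv.sum_comp (Equiv.mulRight γ)]
      refine Finset.sum_congr rfl fun δ _ => ?_
      have hp : γ p = p := hγ
      simp [hp]
    refine ⟨⟨y, hy⟩, ?_⟩
    ext i
    rw [hJ]
    simp only [y, map_smul, map_sum, ← map_mul_apply', smul_smul, mul_inv_cancel₀ hc0, one_smul]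
    rw [Finset.sum_eq_single (Equiv.swap p i)]
    · simp
    · intro δ _ hδ
      exact hK.apply_eq_zero _ (fun h => hδ (mul_inv_eq_one.1 h).symm) _ (h (δ p)).2
    · simp
  exact ⟨√N, LinearIsometryEquiv.ofSurjective ⟨J, hnorm⟩ hsurj, hJ⟩

/-- If the restriction of `V` to the vectors invariant under the whole symmetric group has simple
spectrum, then its restriction to the vectors invariant under the stabilizer of a point has
homogeneous spectrum of multiplicity `k`. -/
theorem IsFundamentalSubspace.hasHomogeneousSpectrum [CompleteSpace K]
    (hK : IsFundamentalSubspace π K)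
    (V : E ≃ₗᵢ[ℂ] E) (hVπ : ∀ γ x, V (π γ x) = π γ (V x))
    (hVK : ∀ x ∈ K, V x ∈ K) (hVK' : ∀ x ∈ K, V.symm x ∈ K)
    {S : Submodule ℂ E} (hS : ∀ x, x ∈ S ↔ ∀ γ, π γ x = x) {U : S ≃ₗᵢ[ℂ] S}
    (hUV : ∀ x, (U x : E) = V x) (hU : HasSimpleSpectrum U) {UF : F ≃ₗᵢ[ℂ] F}
    (hUF : ∀ x, (UF x : E) = V x) : HasHomogeneousSpectrumOfMultiplicity UF k := by
  have hVP : ∀ x, V (K.starProjection x) = K.starProjection (V x) := by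
    intro x
    symm
    apply Submodule.eq_starProjection_of_mem_orthogonal (hVK _ (K.starProjection_apply_mem x))
    rw [← map_sub, Submodule.mem_orthogonal]
    intro u hu
    rw [← V.apply_symm_apply u, V.inner_map_map]
    exact (Submodule.mem_orthogonal _ _).1 (K.sub_starProjection_mem_orthogonal x) _ (hVK' u hu)
  have hW : HasSimpleSpectrum (V.restrictInvariant K hVK hVK') := by
    refine hU.of_surjective (K.orthogonalProjectionOnto.comp S.subtypeL) ?_ ?_
    · intro h
      have hmem : ∑ δ : Equiv.Perm (Fin k), π δ (h : E) ∈ S := by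
        rw [hS]
        intro γ
        simp only [map_sum, ← map_mul_apply']
        exact Equiv.sum_comp (Equiv.mulLeft γ) fun δ => π δ (h : E)
      refine ⟨⟨_, hmem⟩, Subtype.ext ?_⟩
      change K.starProjection (∑ δ : Equiv.Perm (Fin k), π δ (h : E)) = h
      rw [map_sum, Finset.sum_eq_single 1 (fun γ _ hγ => hK.apply_eq_zero γ hγ _ h.2) (by simp)]
      rw [map_one]
      exact Submodule.starProjection_eq_self_iff.2 h.2
    · intro x
      apply Subtype.ext
      change K.starProjection (U x : E) = V (K.starProjection x)
      rw [hUV, hVP]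
  obtain ⟨H, i₁, i₂, W, e₀, hW, he₀⟩ := hW.exists_type
  obtain ⟨c, e, he⟩ := hK.exists_equiv p hF
  refine ⟨H, i₁, i₂, W, hW, e.trans (LinearIsometryEquiv.piLpCongrRight 2 fun _ => e₀), ?_⟩
  intro x i
  change e₀ (e (UF x) i) = W (e₀ (e x i))
  rw [← he₀]
  congr 1
  apply Subtype.ext
  change (e (UF x) i : E) = V (e x i : E)
  rw [he, he, map_smul, hVP, hVπ, hUF]

end Equivalence

end Abstract

end Spectrum

section Koopman

variable {α : Type*} [MeasurableSpace α] {μ : Measure α}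

/-- The Koopman operator of an invertible measure preserving transformation. -/
noncomputable def koopman (e : α ≃ᵐ α) (he : MeasurePreserving e μ μ) :
    Lp ℂ 2 μ ≃ₗᵢ[ℂ] Lp ℂ 2 μ where
  toFun := Lp.compMeasurePreserving e he
  invFun := Lp.compMeasurePreserving e.symm he.symm
  map_add' := map_add _
  map_smul' := (Lp.compMeasurePreservingₗ ℂ e he).map_smul
  left_inv f := by
    refine (Lp.compMeasurePreserving_comp_apply f he he.symm).symm.trans ?_
    simp
  right_inv f := by
    refine (Lp.compMeasurePreserving_comp_apply f he.symm he).symm.trans ?_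
    simp
  norm_map' f := Lp.norm_compMeasurePreserving f he

theorem coeFn_koopman {e : α ≃ᵐ α} (he : MeasurePreserving e μ μ) (f : Lp ℂ 2 μ) :
    koopman e he f =ᵐ[μ] f ∘ e :=
  Lp.coeFn_compMeasurePreserving f he

theorem koopman_symm {e : α ≃ᵐ α} (he : MeasurePreserving e μ μ) :
    (koopman e he).symm = koopman e.symm he.symm :=
  rfl

theorem koopman_koopman_apply {e e' e'' : α ≃ᵐ α} (he : MeasurePreserving e μ μ)
    (he' : MeasurePreserving e' μ μ) (he'' : MeasurePreserving e'' μ μ)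
    (h : ∀ x, e' (e x) = e'' x) (f : Lp ℂ 2 μ) :
    koopman e he (koopman e' he' f) = koopman e'' he'' f := by
  obtain rfl : e.trans e' = e'' := MeasurableEquiv.ext (funext h)
  exact (Lp.compMeasurePreserving_comp_apply f he' he).symm

theorem koopman_comm {a b c d : α ≃ᵐ α} (ha : MeasurePreserving a μ μ)
    (hb : MeasurePreserving b μ μ) (hc : MeasurePreserving c μ μ) (hd : MeasurePreserving d μ μ)
    (h : ∀ x, b (a x) = d (c x)) (f : Lp ℂ 2 μ) :
    koopman a ha (koopman b hb f) = koopman c hc (koopman d hd f) := by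
  rw [koopman_koopman_apply ha hb (ha.trans hb) fun _ => rfl,
    koopman_koopman_apply hc hd (ha.trans hb) fun x => (h x).symm]

end Koopman

/-- An infinite ergodic transformation has no nonzero finite invariant measure which is absolutely
continuous with respect to the given one. -/
theorem Ergodic.eq_zero_of_absolutelyContinuous {X : Type*} [MeasurableSpace X] {μ ν : Measure X}
    [SigmaFinite μ] [IsFiniteMeasure ν] {T : X ≃ᵐ X} (hT : Ergodic T μ) (hμ : μ Set.univ = ∞)
    (hν : MeasurePreserving T ν ν) (hac : ν ≪ μ) : ν = 0 := by
  have hd : μ.withDensity (ν.rnDeriv μ) = ν := Measure.withDensity_rnDeriv_eq ν μ hac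
  have hinv : μ.withDensity (ν.rnDeriv μ ∘ T) = μ.withDensity (ν.rnDeriv μ) := by
    ext s hs
    obtain ⟨t, rfl⟩ : ∃ t, s = T ⁻¹' t := ⟨T.symm ⁻¹' s, by ext; simp⟩
    have ht : MeasurableSet t := T.measurableSet_preimage.1 hs
    rw [hd, hν.measure_preimage_equiv, withDensity_apply _ hs]
    conv_rhs => rw [← hd, withDensity_apply _ ht]
    exact hT.toMeasurePreserving.setLIntegral_comp_preimage ht (Measure.measurable_rnDeriv ν μ)
  have hae : ν.rnDeriv μ ∘ T =ᵐ[μ] ν.rnDeriv μ :=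
    (withDensity_eq_iff_of_sigmaFinite
      ((Measure.measurable_rnDeriv ν μ).comp T.measurable).aemeasurable
      (Measure.measurable_rnDeriv ν μ).aemeasurable).1 hinv
  obtain ⟨c, hc⟩ := hT.ae_eq_const_of_ae_eq_comp₀
    (Measure.measurable_rnDeriv ν μ).nullMeasurable hae
  have hconst : ν = c • μ := by
    rw [← hd, withDensity_congr_ae hc]
    exact withDensity_const c
  have hc0 : c = 0 := by
    by_contra h
    refine measure_ne_top ν Set.univ ?_
    rw [hconst, Measure.smul_apply, hμ, smul_eq_mul, ENNReal.mul_top h]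
  rw [hconst, hc0, zero_smul]

/-- A square integrable function on a product space which is invariant under a measure preserving
transformation acting on one coordinate as an infinite ergodic transformation is zero. -/
theorem Ergodic.eq_zero_of_comp_ae_eq {X : Type*} [MeasurableSpace X] {μ : Measure X}
    [SigmaFinite μ] {T : X ≃ᵐ X} (hT : Ergodic T μ) (hμ : μ Set.univ = ∞) {ι : Type*} [Fintype ι]
    (i : ι) {S : (ι → X) → ι → X}
    (hS : MeasurePreserving S (Measure.pi fun _ => μ) (Measure.pi fun _ => μ))
    (hST : ∀ x, S x i = T (x i)) {f : Lp ℂ 2 (Measure.pi fun _ : ι => μ)}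
    (hf : f ∘ S =ᵐ[Measure.pi fun _ => μ] f) : f = 0 := by
  let m : Measure (ι → X) := Measure.pi fun _ => μ
  have hmeas : Measurable fun x => ‖f x‖ₑ ^ 2 :=
    (Lp.stronglyMeasurable f).measurable.enorm.pow_const 2
  let ρ : Measure (ι → X) := m.withDensity fun x => ‖f x‖ₑ ^ 2
  have hfin : ∫⁻ x, ‖f x‖ₑ ^ 2 ∂m ≠ ∞ := by
    have h := lintegral_rpow_enorm_lt_top_of_eLpNorm_lt_top two_ne_zero ENNReal.ofNat_ne_top
      (Lp.memLp f).eLpNorm_lt_top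
    simpa using h.ne
  have : IsFiniteMeasure ρ := isFiniteMeasure_withDensity hfin
  have hρ : MeasurePreserving S ρ ρ := by
    refine ⟨hS.measurable, ?_⟩
    ext s hs
    rw [Measure.map_apply hS.measurable hs, withDensity_apply _ hs,
      withDensity_apply _ (hS.measurable hs), ← hS.setLIntegral_comp_preimage hs hmeas]
    refine lintegral_congr_ae (ae_restrict_of_ae ?_)
    filter_upwards [hf] with x hx
    rw [← hx]
    rfl
  have hν : MeasurePreserving T (ρ.map (Function.eval i)) (ρ.map (Function.eval i)) := by
    refine ⟨T.measurable, ?_⟩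
    rw [Measure.map_map T.measurable (measurable_pi_apply i)]
    have : T ∘ Function.eval i = Function.eval i ∘ S := funext fun x => (hST x).symm
    rw [this, ← Measure.map_map (measurable_pi_apply i) hS.measurable, hρ.map_eq]
  have hac : ρ.map (Function.eval i) ≪ μ :=
    ((withDensity_absolutelyContinuous m _).map (measurable_pi_apply i)).trans
      (Measure.quasiMeasurePreserving_eval (fun _ => μ) i).absolutelyContinuous
  have hzero := hT.eq_zero_of_absolutelyContinuous hμ hν hac
  rw [Measure.map_eq_zero_iff (measurable_pi_apply i).aemeasurable,
    withDensity_eq_zero_iff hmeas.aemeasurable] at hzero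
  rw [Lp.eq_zero_iff_ae_eq_zero]
  filter_upwards [hzero] with x hx
  simpa using hx

section SelfAdjointPart

variable {E : Type*} [NormedAddCommGroup E] [InnerProductSpace ℂ E] [CompleteSpace E]

/-- The sum of a unitary operator and its inverse. -/
noncomputable def addInverse (U : E ≃ₗᵢ[ℂ] E) : E →L[ℂ] E :=
  (U : E →L[ℂ] E) + (U.symm : E →L[ℂ] E)

omit [CompleteSpace E] in
theorem addInverse_apply (U : E ≃ₗᵢ[ℂ] E) (x : E) : addInverse U x = U x + U.symm x :=
  rfl

theorem isSelfAdjoint_addInverse (U : E ≃ₗᵢ[ℂ] E) : IsSelfAdjoint (addInverse U) := by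
  rw [IsSelfAdjoint, addInverse, star_add, LinearIsometryEquiv.star_eq_symm,
    LinearIsometryEquiv.star_eq_symm, LinearIsometryEquiv.symm_symm, add_comm]

omit [CompleteSpace E] in
theorem apply_addInverse {U W S : E ≃ₗᵢ[ℂ] E} (h : ∀ x, S (U x) = W (S x)) (x : E) :
    S (addInverse U x) = addInverse W (S x) := by
  rw [addInverse_apply, addInverse_apply, map_add, h, add_right_inj,
    LinearIsometryEquiv.eq_symm_apply, ← h, U.apply_symm_apply]

omit [CompleteSpace E] in
theorem addInverse_commute {U W : E ≃ₗᵢ[ℂ] E} (h : ∀ x, W (U x) = U (W x)) :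
    Commute (addInverse U) (addInverse W) := by
  have h' : ∀ x, W.symm (U x) = U (W.symm x) := fun x => by
    rw [LinearIsometryEquiv.symm_apply_eq, h, W.apply_symm_apply]
  ext x
  change addInverse U (addInverse W x) = addInverse W (addInverse U x)
  rw [addInverse_apply W, addInverse_apply W, map_add, apply_addInverse h, apply_addInverse h']

omit [CompleteSpace E] in
/-- The difference of the operators `U + U⁻¹` and `W + W⁻¹` factors as
`(U - W) (1 - U⁻¹ W⁻¹)`. -/
theorem eq_zero_of_addInverse_apply_eq {U W : E ≃ₗᵢ[ℂ] E} (h : ∀ x, W (U x) = U (W x))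
    (h₁ : ∀ x, W.symm (U x) = x → x = 0) (h₂ : ∀ x, W (U x) = x → x = 0) {x : E}
    (hx : addInverse U x = addInverse W x) : x = 0 := by
  have hU : ∀ y, U (W.symm (U.symm y)) = W.symm y := fun y => by
    rw [LinearIsometryEquiv.eq_symm_apply, h, W.apply_symm_apply, U.apply_symm_apply]
  have hy : x - W.symm (U.symm x) = 0 := by
    apply h₁
    rw [LinearIsometryEquiv.symm_apply_eq, map_sub, map_sub, hU, W.apply_symm_apply,
      sub_eq_sub_iff_add_eq_add]
    exact hx
  apply h₂
  rw [h]
  conv_lhs => rw [sub_eq_zero.1 hy, W.apply_symm_apply, U.apply_symm_apply]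

theorem apply_mem_orderSubspace_addInverse {k : ℕ} {U : Fin k → E ≃ₗᵢ[ℂ] E} {S : E ≃ₗᵢ[ℂ] E}
    (hS : ∀ i x, S (U i x) = U i (S x)) {σ : Equiv.Perm (Fin k)} {x : E}
    (hx : x ∈ orderSubspace (fun i => addInverse (U i)) σ) :
    S x ∈ orderSubspace (fun i => addInverse (U i)) σ :=
  apply_mem_orderSubspace_of_commute (S := (S : E →L[ℂ] E))
    (fun i => ContinuousLinearMap.ext fun y => (apply_addInverse (hS i) y).symm) hx

/-- A unitary representation of the symmetric group permuting commuting self-adjoint operators,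
no two of which agree at a nonzero vector, has a fundamental subspace. -/
theorem isFundamentalSubspace_orderSubspace {k : ℕ} {A : Fin k → E →L[ℂ] E}
    (hA : ∀ i, IsSelfAdjoint (A i)) (hcomm : ∀ i j, Commute (A i) (A j))
    (hinj : ∀ i j, i ≠ j → ∀ x, A i x = A j x → x = 0)
    {π : Equiv.Perm (Fin k) →* (E ≃ₗᵢ[ℂ] E)} (hπ : ∀ γ i x, π γ (A i x) = A (γ i) (π γ x)) :
    IsFundamentalSubspace π (orderSubspace A 1) := by
  have hmaps : ∀ γ σ, ∀ x ∈ orderSubspace A σ, π γ x ∈ orderSubspace A (γ * σ) := fun γ σ x hx =>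
    mem_orderSubspace.2 fun a b hab => apply_mem_leSubspace_of_semiconj (hA _) (hA _) (π γ)
      (hπ γ _) (hπ γ _) (mem_orderSubspace.1 hx a b hab)
  have hinv : ∀ γ x, π γ (π γ⁻¹ x) = x := fun γ x => by
    rw [← map_mul_apply', mul_inv_cancel, map_one]
    rfl
  constructor
  · intro x
    conv_rhs => rw [← sum_starProjection_orderSubspace hA hcomm hinj x]
    refine Finset.sum_congr rfl fun γ _ => ?_
    conv_rhs => rw [← hinv γ x]
    refine apply_starProjection_of_mapsTo (π γ : E →L[ℂ] E) (fun y hy => ?_) (fun y hy => ?_) _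
    · simpa using hmaps γ 1 y hy
    · rw [LinearIsometryEquiv.star_eq_symm]
      have hs : (π γ).symm y = π γ⁻¹ y := by
        rw [LinearIsometryEquiv.symm_apply_eq, hinv]
      have := hmaps γ⁻¹ γ y hy
      rw [inv_mul_cancel, ← hs] at this
      exact this
  · intro γ hγ x hx
    rw [Submodule.starProjection_apply_eq_zero_iff, Submodule.mem_orthogonal]
    intro u hu
    refine inner_eq_zero_of_mem_orderSubspace hA hcomm hinj hγ.symm hu ?_
    simpa using hmaps γ 1 x hx

end SelfAdjointPart

section Product

variable {ι X : Type*} [MeasurableSpace X]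

/-- The transformation of `ι → X` acting on the `i`-th coordinate as `T`. -/
def coordEquiv [DecidableEq ι] (T : X ≃ᵐ X) (i : ι) : (ι → X) ≃ᵐ (ι → X) :=
  MeasurableEquiv.piCongrRight (Function.update (fun _ => MeasurableEquiv.refl X) i T)

theorem coordEquiv_apply [DecidableEq ι] (T : X ≃ᵐ X) (i : ι) (x : ι → X) (j : ι) :
    coordEquiv T i x j = if j = i then T (x j) else x j := by
  by_cases h : j = i
  · subst h
    simp [coordEquiv, MeasurableEquiv.piCongrRight]
  · simp [coordEquiv, MeasurableEquiv.piCongrRight, h]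

theorem coordEquiv_symm [DecidableEq ι] (T : X ≃ᵐ X) (i : ι) :
    (coordEquiv T i).symm = coordEquiv T.symm i := by
  ext x j
  rw [coordEquiv_apply]
  by_cases h : j = i
  · subst h
    simp [coordEquiv, MeasurableEquiv.piCongrRight]
  · simp [coordEquiv, MeasurableEquiv.piCongrRight, h]

/-- The permutation of the coordinates of `ι → X` given by `γ`. -/
def permEquiv (γ : Equiv.Perm ι) : (ι → X) ≃ᵐ (ι → X) where
  toFun x := x ∘ γ
  invFun x := x ∘ γ.symm
  left_inv x := by ext; simp
  right_inv x := by ext; simp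
  measurable_toFun := measurable_pi_lambda _ fun _ => measurable_pi_apply _
  measurable_invFun := measurable_pi_lambda _ fun _ => measurable_pi_apply _

theorem permEquiv_apply (γ : Equiv.Perm ι) (x : ι → X) : permEquiv γ x = x ∘ γ :=
  rfl

variable [Fintype ι] {μ : Measure X} [SigmaFinite μ] {T : X ≃ᵐ X} (hT : MeasurePreserving T μ μ)

include hT in
theorem measurePreserving_coordEquiv [DecidableEq ι] (i : ι) :
    MeasurePreserving (coordEquiv T i) (Measure.pi fun _ => μ) (Measure.pi fun _ => μ) := by
  refine measurePreserving_pi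
    (f := fun j => Function.update (fun _ => MeasurableEquiv.refl X) i T j) _ _ fun j => ?_
  by_cases h : j = i
  · subst h
    simpa using hT
  · rw [Function.update_of_ne h]
    exact MeasurePreserving.id μ

/-- The Koopman operator of the transformation acting on the `i`-th coordinate as `T`. -/
noncomputable def coordKoopman [DecidableEq ι] (i : ι) :
    Lp ℂ 2 (Measure.pi fun _ : ι => μ) ≃ₗᵢ[ℂ] Lp ℂ 2 (Measure.pi fun _ : ι => μ) :=
  koopman (coordEquiv T i) (measurePreserving_coordEquiv hT i)

/-- The diagonal transformation `T × ⋯ × T` of `ι → X`. -/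
def diagEquiv (T : X ≃ᵐ X) : (ι → X) ≃ᵐ (ι → X) :=
  MeasurableEquiv.piCongrRight fun _ => T

include hT in
theorem measurePreserving_diagEquiv :
    MeasurePreserving (diagEquiv T) (Measure.pi fun _ : ι => μ) (Measure.pi fun _ => μ) :=
  measurePreserving_pi _ _ fun _ => hT

/-- The Koopman operator of the diagonal transformation `T × ⋯ × T`. -/
noncomputable def diagKoopman :
    Lp ℂ 2 (Measure.pi fun _ : ι => μ) ≃ₗᵢ[ℂ] Lp ℂ 2 (Measure.pi fun _ : ι => μ) :=
  koopman (diagEquiv T) (measurePreserving_diagEquiv hT)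

theorem lpFun_diagKoopman (f : Lp ℂ 2 (Measure.pi fun _ : ι => μ)) :
    lpFun (diagKoopman hT f) =ᵐ[Measure.pi fun _ => μ] fun x => lpFun f fun i => T (x i) :=
  coeFn_koopman (measurePreserving_diagEquiv hT) f

theorem diagKoopman_coordKoopman [DecidableEq ι] (i : ι) (f : Lp ℂ 2 (Measure.pi fun _ : ι => μ)) :
    diagKoopman hT (coordKoopman hT i f) = coordKoopman hT i (diagKoopman hT f) := by
  refine koopman_comm _ _ _ _ (fun x => ?_) f
  ext j
  change coordEquiv T i (diagEquiv T x) j = T (coordEquiv T i x j)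
  rw [coordEquiv_apply, coordEquiv_apply]
  split_ifs <;> rfl

theorem coordKoopman_comm [DecidableEq ι] (i j : ι) (f : Lp ℂ 2 (Measure.pi fun _ : ι => μ)) :
    coordKoopman hT i (coordKoopman hT j f) = coordKoopman hT j (coordKoopman hT i f) := by
  refine koopman_comm _ _ _ _ (fun x => ?_) f
  ext l
  simp only [coordEquiv_apply]
  split_ifs <;> rfl

theorem eq_zero_of_coordKoopman_apply_eq_self [DecidableEq ι] (herg : Ergodic T μ)
    (hμ : μ Set.univ = ∞) {i j : ι} (hij : i ≠ j) {f : Lp ℂ 2 (Measure.pi fun _ : ι => μ)}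
    (hf : coordKoopman hT j (coordKoopman hT i f) = f) : f = 0 := by
  have hS := (measurePreserving_coordEquiv hT j).trans (measurePreserving_coordEquiv hT i)
  rw [coordKoopman, coordKoopman, koopman_koopman_apply _ _ hS fun _ => rfl] at hf
  refine herg.eq_zero_of_comp_ae_eq hμ i hS (fun x => ?_) ((coeFn_koopman hS f).symm.trans ?_)
  · change coordEquiv T i (coordEquiv T j x) i = _
    simp [coordEquiv_apply, hij]
  · rw [hf]

theorem eq_zero_of_coordKoopman_symm_apply_eq_self [DecidableEq ι] (herg : Ergodic T μ)
    (hμ : μ Set.univ = ∞) {i j : ι} (hij : i ≠ j) {f : Lp ℂ 2 (Measure.pi fun _ : ι => μ)}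
    (hf : (coordKoopman hT j).symm (coordKoopman hT i f) = f) : f = 0 := by
  have hS := (measurePreserving_coordEquiv hT j).symm.trans (measurePreserving_coordEquiv hT i)
  rw [coordKoopman, coordKoopman, koopman_symm, koopman_koopman_apply _ _ hS fun _ => rfl] at hf
  refine herg.eq_zero_of_comp_ae_eq hμ i hS (fun x => ?_) ((coeFn_koopman hS f).symm.trans ?_)
  · change coordEquiv T i ((coordEquiv T j).symm x) i = _
    simp [coordEquiv_symm, coordEquiv_apply, hij]
  · rw [hf]

end Product

section Permutations

variable {X : Type*} [MeasurableSpace X] {k : ℕ} (μ : Measure X) [SigmaFinite μ]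

/-- The unitary representation of the symmetric group by permutations of coordinates. -/
noncomputable def permKoopman : Equiv.Perm (Fin k) →*
    (Lp ℂ 2 (Measure.pi fun _ : Fin k => μ) ≃ₗᵢ[ℂ] Lp ℂ 2 (Measure.pi fun _ : Fin k => μ)) where
  toFun γ := koopman (permEquiv γ) (permMeasurePreserving k μ γ)
  map_one' := by
    ext1 f
    exact Lp.compMeasurePreserving_id_apply f
  map_mul' γ δ := by
    ext1 f
    exact (koopman_koopman_apply (permMeasurePreserving k μ γ) (permMeasurePreserving k μ δ)
      (permMeasurePreserving k μ (γ * δ)) (fun _ => rfl) f).symm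

variable {μ}

theorem mem_permInvariantSubspace {Γ : Subgroup (Equiv.Perm (Fin k))}
    {f : Lp ℂ 2 (Measure.pi fun _ : Fin k => μ)} :
    f ∈ permInvariantSubspace k μ Γ ↔ ∀ γ ∈ Γ, permKoopman μ γ f = f := by
  have h : ∀ γ, permKoopman μ γ f = f ↔
      f ∘ (fun x => x ∘ γ) =ᵐ[Measure.pi fun _ : Fin k => μ] f := fun γ => by
    rw [Lp.ext_iff]
    have := coeFn_koopman (e := permEquiv γ) (permMeasurePreserving k μ γ) f
    exact ⟨this.symm.trans, this.trans⟩
  simp only [h]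
  constructor
  · intro hf γ hγ
    exact hf _ ⟨γ, hγ, rfl⟩
  · rintro hf _ ⟨γ, hγ, rfl⟩
    exact hf γ hγ

variable {T : X ≃ᵐ X} (hT : MeasurePreserving T μ μ)

theorem permKoopman_coordKoopman (γ : Equiv.Perm (Fin k)) (i : Fin k)
    (f : Lp ℂ 2 (Measure.pi fun _ : Fin k => μ)) :
    permKoopman μ γ (coordKoopman hT i f) = coordKoopman hT (γ i) (permKoopman μ γ f) := by
  refine koopman_comm _ _ _ _ (fun x => ?_) f
  ext j
  simp [coordEquiv_apply, permEquiv_apply]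

theorem diagKoopman_permKoopman (γ : Equiv.Perm (Fin k))
    (f : Lp ℂ 2 (Measure.pi fun _ : Fin k => μ)) :
    diagKoopman hT (permKoopman μ γ f) = permKoopman μ γ (diagKoopman hT f) :=
  koopman_comm (a := diagEquiv T) (b := permEquiv γ) (c := permEquiv γ) (d := diagEquiv T)
    (measurePreserving_diagEquiv hT) (permMeasurePreserving k μ γ)
    (permMeasurePreserving k μ γ) (measurePreserving_diagEquiv hT) (fun _ => rfl) f

theorem diagKoopman_mem_permInvariantSubspace {Γ : Subgroup (Equiv.Perm (Fin k))}
    {f : Lp ℂ 2 (Measure.pi fun _ : Fin k => μ)} (hf : f ∈ permInvariantSubspace k μ Γ) :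
    diagKoopman hT f ∈ permInvariantSubspace k μ Γ :=
  mem_permInvariantSubspace.2 fun γ hγ => by
    rw [← diagKoopman_permKoopman, mem_permInvariantSubspace.1 hf γ hγ]

theorem diagKoopman_symm_mem_permInvariantSubspace {Γ : Subgroup (Equiv.Perm (Fin k))}
    {f : Lp ℂ 2 (Measure.pi fun _ : Fin k => μ)} (hf : f ∈ permInvariantSubspace k μ Γ) :
    (diagKoopman hT).symm f ∈ permInvariantSubspace k μ Γ :=
  mem_permInvariantSubspace.2 fun γ hγ => by
    rw [LinearIsometryEquiv.eq_symm_apply, diagKoopman_permKoopman,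
      LinearIsometryEquiv.apply_symm_apply, mem_permInvariantSubspace.1 hf γ hγ]

/-- The part of `L²(X^k)` on which the self-adjoint operators `Uᵢ + Uᵢ⁻¹`, where `Uᵢ` is the
Koopman operator of `T` acting on the `i`-th coordinate, are increasingly ordered. -/
noncomputable def increasingSubspace : Submodule ℂ (Lp ℂ 2 (Measure.pi fun _ : Fin k => μ)) :=
  orderSubspace (fun i => addInverse (coordKoopman hT i)) 1

noncomputable instance : CompleteSpace (increasingSubspace (k := k) hT) :=
  inferInstanceAs (CompleteSpace (orderSubspace _ _))

theorem isFundamentalSubspace_increasingSubspace (herg : Ergodic T μ) (hμ : μ Set.univ = ∞) :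
    IsFundamentalSubspace (permKoopman μ) (increasingSubspace (k := k) hT) :=
  isFundamentalSubspace_orderSubspace (fun _ => isSelfAdjoint_addInverse _)
    (fun i j => addInverse_commute (coordKoopman_comm hT j i))
    (fun i j hij _ hf => eq_zero_of_addInverse_apply_eq (coordKoopman_comm hT j i)
      (fun _ => eq_zero_of_coordKoopman_symm_apply_eq_self hT herg hμ hij)
      (fun _ => eq_zero_of_coordKoopman_apply_eq_self hT herg hμ hij) hf)
    (fun γ i => apply_addInverse (permKoopman_coordKoopman hT γ i))

theorem apply_mem_increasingSubspace
    {S : Lp ℂ 2 (Measure.pi fun _ : Fin k => μ) ≃ₗᵢ[ℂ] Lp ℂ 2 (Measure.pi fun _ : Fin k => μ)}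
    (hS : ∀ i f, S (coordKoopman hT i f) = coordKoopman hT i (S f))
    {f : Lp ℂ 2 (Measure.pi fun _ : Fin k => μ)} (hf : f ∈ increasingSubspace hT) :
    S f ∈ increasingSubspace hT :=
  apply_mem_orderSubspace_addInverse hS hf

end Permutations

/-- Corollary 1.2.  Let `T` be an ergodic conservative infinite
measure preserving transformation such that `U_T^{⊙k}` (the restriction of the
Koopman operator of `T^{×k}` to symmetric functions) has a simple spectrum.  Then
the Koopman operator of `T^{⊙(k−1)} × T`, i.e. the restriction of the Koopman
operator of `T^{×k}` to the subspace of functions invariant under the permutations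
of the first `k−1` coordinates, has homogeneous spectrum of multiplicity `k`. -/
theorem koopman_symmPow_mul_self_homogeneous_spectrum
    {X : Type*} [MeasurableSpace X] [StandardBorelSpace X]
    (μ : Measure X) [SigmaFinite μ] (hinf : μ Set.univ = ∞)
    (T : X ≃ᵐ X) (hT : MeasurePreserving T μ μ)
    (herg : Ergodic T μ) (hcons : Conservative T μ)
    (k : ℕ) (hk : 0 < k)
    (hsimple : ∀ Usym : ↥(permInvariantSubspace k μ ⊤) ≃ₗᵢ[ℂ]
        ↥(permInvariantSubspace k μ ⊤),
      (∀ f : ↥(permInvariantSubspace k μ ⊤),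
        lpFun (Usym f : Lp ℂ 2 (Measure.pi fun _ : Fin k => μ))
          =ᵐ[Measure.pi fun _ : Fin k => μ]
          fun x => lpFun (f : Lp ℂ 2 (Measure.pi fun _ : Fin k => μ))
            (fun i => T (x i))) →
      HasSimpleSpectrum Usym) :
    ∀ UΓ : ↥(permInvariantSubspace k μ
          (MulAction.stabilizer (Equiv.Perm (Fin k)) (⟨k - 1, by omega⟩ : Fin k)))
        ≃ₗᵢ[ℂ] ↥(permInvariantSubspace k μ
          (MulAction.stabilizer (Equiv.Perm (Fin k)) (⟨k - 1, by omega⟩ : Fin k))),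
      (∀ f, lpFun (UΓ f : Lp ℂ 2 (Measure.pi fun _ : Fin k => μ))
          =ᵐ[Measure.pi fun _ : Fin k => μ]
          fun x => lpFun (f : Lp ℂ 2 (Measure.pi fun _ : Fin k => μ))
            (fun i => T (x i))) →
      HasHomogeneousSpectrumOfMultiplicity UΓ k := by
  intro UΓ hUΓ
  have hK := isFundamentalSubspace_increasingSubspace (k := k) hT herg hinf
  have hsym : HasSimpleSpectrum ((diagKoopman hT).restrictInvariant (permInvariantSubspace k μ ⊤)
      (fun _ => diagKoopman_mem_permInvariantSubspace hT)
      fun _ => diagKoopman_symm_mem_permInvariantSubspace hT) := by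
    refine hsimple _ fun f => ?_
    rw [LinearIsometryEquiv.coe_restrictInvariant_apply]
    exact lpFun_diagKoopman hT (f : Lp ℂ 2 (Measure.pi fun _ : Fin k => μ))
  exact hK.hasHomogeneousSpectrum _ (fun _ => mem_permInvariantSubspace) (diagKoopman hT)
    (diagKoopman_permKoopman hT)
    (fun _ => apply_mem_increasingSubspace hT (diagKoopman_coordKoopman hT))
    (fun _ => apply_mem_increasingSubspace hT fun i g => by
      rw [LinearIsometryEquiv.symm_apply_eq, diagKoopman_coordKoopman,
        LinearIsometryEquiv.apply_symm_apply])
    (fun _ => mem_permInvariantSubspace.trans (by simp))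
    (LinearIsometryEquiv.coe_restrictInvariant_apply _ _ _) hsym
    fun f => Lp.ext ((hUΓ f).trans
      (lpFun_diagKoopman hT (f : Lp ℂ 2 (Measure.pi fun _ : Fin k => μ))).symm)
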